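/- Let Λ be an Artin algebra and T a cotilting finitely generated left Λ-module with injective dimension d. Then resdim_{⊥T}(M) ≤ d for every finitely generated left Λ-module M, and there exists a finitely generated left Λ-module M with resdim_{⊥T}(M) = d; that is, id(T) = resdim_{⊥T}(mod(Λ)). -/

import Mathlib

universe u

open CategoryTheory

/-- `ExtGrp Λ i M N` is the `i`-th Ext group `Ext^i_Λ(M, N)`, computed in the abelian
category of `Λ`-modules. Its vanishing is expressed as `Subsingleton (ExtGrp Λ i M N)`. -/
noncomputable abbrev ExtGrp (Λ : Type u) [Ring Λ] (i : ℕ) (M N : ModuleCat.{u} Λ) :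
    Type u :=
  ((Ext ℤ (ModuleCat.{u} Λ) i).obj (Opposite.op M)).obj N

/-- `ResolutionOfLength Λ D n M` : there is an exact sequence
`0 → X_n → ⋯ → X_1 → X_0 → M → 0` in `mod Λ` with all `X_i ∈ D`. -/
def ResolutionOfLength (Λ : Type u) [Ring Λ] (D : Set (ModuleCat.{u} Λ)) :
    ℕ → ModuleCat.{u} Λ → Prop
  | 0, M => ∃ X ∈ D, Nonempty ((X : Type u) ≃ₗ[Λ] (M : Type u))
  | n + 1, M => ∃ X ∈ D, ∃ (K : ModuleCat.{u} Λ) (f : K →ₗ[Λ] X) (g : X →ₗ[Λ] M),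
      Function.Injective f ∧ Function.Surjective g ∧ Function.Exact f g ∧
        ResolutionOfLength Λ D n K

/-- `ResdimLE Λ D k M` : the `D`-resolution dimension of `M` is at most `k`. -/
def ResdimLE (Λ : Type u) [Ring Λ] (D : Set (ModuleCat.{u} Λ)) (k : ℕ)
    (M : ModuleCat.{u} Λ) : Prop :=
  ∃ n ≤ k, ResolutionOfLength Λ D n M

/-- `AddClass Λ T` is `add T`, the class of direct summands of finite direct sums of
copies of `T`. -/
def AddClass (Λ : Type u) [Ring Λ] (T : ModuleCat.{u} Λ) : Set (ModuleCat.{u} Λ) :=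
  {M | ∃ (N : ModuleCat.{u} Λ) (r : ℕ),
    Nonempty ((↥M × ↥N) ≃ₗ[Λ] (Fin r → (T : Type u)))}

/-- `Perp Λ T` is `⊥T`, the class of finitely generated modules `M` with
`Ext^i_Λ(M, T) = 0` for all `i ≥ 1`. -/
def Perp (Λ : Type u) [Ring Λ] (T : ModuleCat.{u} Λ) : Set (ModuleCat.{u} Λ) :=
  {M | Module.Finite Λ M ∧ ∀ i : ℕ, 1 ≤ i → Subsingleton (ExtGrp Λ i M T)}

/-- `AddWedge Λ T` is `(add T)^∧`, the class of finitely generated modules of finite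
`add T`-resolution dimension. -/
def AddWedge (Λ : Type u) [Ring Λ] (T : ModuleCat.{u} Λ) : Set (ModuleCat.{u} Λ) :=
  {M | Module.Finite Λ M ∧ ∃ k : ℕ, ResdimLE Λ (AddClass Λ T) k M}

/-- `T` is a cotilting module: it is finitely generated, has finite injective
dimension, `Ext^i_Λ(T, T) = 0` for all `i ≥ 1`, and every finitely generated
injective module has finite `add T`-resolution dimension. -/
def IsCotilting (Λ : Type u) [Ring Λ] (T : ModuleCat.{u} Λ) : Prop :=
  Module.Finite Λ T ∧
  (∃ d : ℕ, ∀ (M : ModuleCat.{u} Λ) (j : ℕ), d < j → Subsingleton (ExtGrp Λ j M T)) ∧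
  (∀ i : ℕ, 1 ≤ i → Subsingleton (ExtGrp Λ i T T)) ∧
  (∀ I : ModuleCat.{u} Λ, Module.Finite Λ I → Module.Injective Λ I →
    ∃ k : ℕ, ResdimLE Λ (AddClass Λ T) k I)

/-!
Theorem 4.8(a) of the paper: for an Artin algebra `Λ` and a cotilting finitely
generated left `Λ`-module `T` of injective dimension `d`, one has
`resdim_{⊥T}(M) ≤ d` for every finitely generated `M`, and this bound is attained;
that is, `id(T) = resdim_{⊥T}(mod Λ)`.
-/

open Abelian in
theorem aux_bridge (Λ : Type u) [Ring Λ] (n : ℕ) (M N : ModuleCat.{u} Λ) :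
    Subsingleton (ExtGrp Λ (n + 1) M N) ↔
      Subsingleton (Abelian.Ext.{u} M N (n + 1)) := by
  let P := projectiveResolution M
  have h1 : Subsingleton (Abelian.Ext.{u} M N (n + 1)) ↔
      ∀ f : P.complex.X (n + 1) ⟶ N, P.complex.d (n + 2) (n + 1) ≫ f = 0 →
        ∃ g : P.complex.X n ⟶ N, P.complex.d (n + 1) n ≫ g = f := by
    constructor
    · intro h f hf
      exact (P.extMk_eq_zero_iff f (n + 2) rfl hf n rfl).1 (Subsingleton.elim _ _)
    · intro h
      refine subsingleton_of_forall_eq 0 fun α => ?_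
      obtain ⟨f, hf, rfl⟩ := P.extMk_surjective α (n + 2) rfl
      exact (P.extMk_eq_zero_iff f (n + 2) rfl hf n rfl).2 (h f hf)
  rw [h1]
  have h2 := (P.isoExt (R := ℤ) (n + 1) N)
  have h3 : Subsingleton (ExtGrp Λ (n + 1) M N) ↔
      Limits.IsZero ((P.complex.linearYonedaObj ℤ N).homology (n + 1)) := by
    rw [← h2.isZero_iff, ModuleCat.isZero_iff_subsingleton]
  rw [h3, ← HomologicalComplex.exactAt_iff_isZero_homology,
    HomologicalComplex.exactAt_iff' _ n (n + 1) (n + 2) (by simp) (by simp),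
    ShortComplex.moduleCat_exact_iff]
  rfl

theorem aux_shortExact {Λ : Type u} [Ring Λ] {K X M : ModuleCat.{u} Λ} (f : K →ₗ[Λ] X)
    (g : X →ₗ[Λ] M) (hf : Function.Injective f) (hg : Function.Surjective g)
    (h : Function.Exact f g) :
    (ModuleCat.shortComplexOfCompEqZero f g h.linearMap_comp_eq_zero).ShortExact :=
  ModuleCat.shortComplex_shortExact _ h hf hg

/-- dimension shifting, both directions -/
theorem aux_shift {Λ : Type u} [Ring Λ] {K X M : ModuleCat.{u} Λ} (T : ModuleCat.{u} Λ)
    (f : K →ₗ[Λ] X)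
    (g : X →ₗ[Λ] M) (hf : Function.Injective f) (hg : Function.Surjective g)
    (h : Function.Exact f g) (hX : ∀ i : ℕ, 1 ≤ i → Subsingleton (ExtGrp Λ i X T)) (n : ℕ) :
    Subsingleton (ExtGrp Λ (n + 1) K T) ↔ Subsingleton (ExtGrp Λ (n + 2) M T) := by
  have hS := aux_shortExact f g hf hg h
  have hX1 := (aux_bridge Λ n X T).1 (hX _ (by omega))
  have hX2 := (aux_bridge Λ (n + 1) X T).1 (hX _ (by omega))
  rw [aux_bridge, aux_bridge]
  constructor
  · intro hK
    refine subsingleton_of_forall_eq 0 fun x => ?_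
    obtain ⟨y, rfl⟩ := Abelian.Ext.contravariant_sequence_exact₃ hS T x
      (hX2.elim _ _) (n₀ := n + 1) (by omega)
    rw [hK.elim y 0, Abelian.Ext.comp_zero]
  · intro hM
    refine subsingleton_of_forall_eq 0 fun x => ?_
    obtain ⟨y, rfl⟩ := Abelian.Ext.contravariant_sequence_exact₁ hS T x
      (n₁ := n + 2) (by omega) (hM.elim _ _)
    rw [hX1.elim y 0, Abelian.Ext.comp_zero]

/-- Baer criterion for higher Ext. -/
theorem aux_baer {Λ : Type u} [Ring Λ] (n : ℕ) : ∀ (N : ModuleCat.{u} Λ),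
    (∀ M : ModuleCat.{u} Λ, Module.Finite Λ M → Subsingleton (Abelian.Ext.{u} M N (n + 1))) →
    ∀ M : ModuleCat.{u} Λ, Subsingleton (Abelian.Ext.{u} M N (n + 1)) := by
  induction n with
  | zero =>
    intro N hN M
    have hB : Module.Baer Λ N := by
      intro I g
      have hS := aux_shortExact (K := ModuleCat.of Λ I) (X := ModuleCat.of Λ Λ)
        (M := ModuleCat.of Λ (Λ ⧸ I)) I.subtype I.mkQ I.injective_subtype I.mkQ_surjective
        (LinearMap.exact_subtype_mkQ I)
      have hfin : Module.Finite Λ (ModuleCat.of Λ (Λ ⧸ I)) :=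
        inferInstanceAs (Module.Finite Λ (Λ ⧸ I))
      have := hN (ModuleCat.of Λ (Λ ⧸ I)) hfin
      obtain ⟨y, hy⟩ := Abelian.Ext.contravariant_sequence_exact₁ hS N
        (Abelian.Ext.mk₀ (ModuleCat.ofHom g)) (n₁ := 1) (by omega) (this.elim _ _)
      obtain ⟨k, rfl⟩ := Abelian.Ext.homEquiv₀.symm.surjective y
      rw [Abelian.Ext.homEquiv₀_symm_apply, Abelian.Ext.mk₀_comp_mk₀] at hy
      have hy' := Abelian.Ext.homEquiv₀.symm.injective hy
      refine ⟨k.hom, fun x hx => ?_⟩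
      exact congrArg (fun q => q.hom ⟨x, hx⟩) hy'
    have hinj : Module.Injective Λ N := hB.injective
    have : Injective N := (Module.injective_iff_injective_object Λ N).1 hinj
    exact HasInjectiveDimensionLT.subsingleton N 1 1 le_rfl M
  | succ n ih =>
    intro N hN M
    let ⟨I, _, f, _⟩ := EnoughInjectives.presentation N
    have injf : Function.Injective f.hom := (ModuleCat.mono_iff_injective f).mp ‹_›
    have hS := aux_shortExact (K := N) (X := I)
        (M := ModuleCat.of Λ (I ⧸ f.hom.range)) f.hom f.hom.range.mkQ injf
        (Submodule.mkQ_surjective _) f.hom.exact_map_mkQ_range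
    have hI : ∀ (i : ℕ) (Y : ModuleCat.{u} Λ), Subsingleton (Abelian.Ext.{u} Y I (i + 1)) :=
      fun i Y => HasInjectiveDimensionLT.subsingleton I 1 (i + 1) (by omega) Y
    have hC := ih (ModuleCat.of Λ (I ⧸ f.hom.range)) (fun Y hY => by
      have h2 := hN Y hY
      refine subsingleton_of_forall_eq 0 fun x => ?_
      obtain ⟨y, rfl⟩ := Abelian.Ext.covariant_sequence_exact₃ Y hS x
        (n₁ := n + 2) (by omega) (h2.elim _ _)
      rw [(hI n Y).elim y 0, Abelian.Ext.zero_comp]) M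
    refine subsingleton_of_forall_eq 0 fun x => ?_
    obtain ⟨y, rfl⟩ := Abelian.Ext.covariant_sequence_exact₁ M hS x
      ((hI (n + 1) M).elim _ _) (n₀ := n + 1) (by omega)
    rw [hC.elim y 0, Abelian.Ext.zero_comp]

theorem aux_proj {Λ : Type u} [Ring Λ] (X T : ModuleCat.{u} Λ) [Module.Projective Λ X]
    (i : ℕ) (hi : 1 ≤ i) : Subsingleton (ExtGrp Λ i X T) := by
  obtain ⟨n, rfl⟩ : ∃ n, i = n + 1 := ⟨i - 1, by omega⟩
  have : Projective X := (IsProjective.iff_projective X).1 inferInstance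
  exact ModuleCat.isZero_iff_subsingleton.1 (isZero_Ext_succ_of_projective X T n)

theorem aux_upper {Λ : Type u} [Ring Λ] [IsNoetherianRing Λ] (T : ModuleCat.{u} Λ) (n : ℕ) :
    ∀ M : ModuleCat.{u} Λ, Module.Finite Λ M →
      (∀ j : ℕ, n < j → Subsingleton (ExtGrp Λ j M T)) →
      ResolutionOfLength Λ (Perp Λ T) n M := by
  induction n with
  | zero =>
    intro M hM h
    exact ⟨M, ⟨hM, fun i hi => h i hi⟩, ⟨LinearEquiv.refl _ _⟩⟩
  | succ n ih =>
    intro M hM h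
    obtain ⟨r, g, hg⟩ := Module.Finite.exists_fin' Λ M
    have hP := aux_proj (ModuleCat.of Λ (Fin r → Λ)) T
    have hfin : Module.Finite Λ (ModuleCat.of Λ (Fin r → Λ)) :=
      inferInstanceAs (Module.Finite Λ (Fin r → Λ))
    have hex : Function.Exact (LinearMap.ker g).subtype g := LinearMap.exact_subtype_ker_map g
    refine ⟨ModuleCat.of Λ (Fin r → Λ), ⟨hfin, hP⟩, ModuleCat.of Λ (LinearMap.ker g),
      (LinearMap.ker g).subtype, g, Submodule.injective_subtype _, hg, hex,
      ih _ (inferInstanceAs (Module.Finite Λ (LinearMap.ker g))) fun j hj => ?_⟩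
    obtain ⟨m, rfl⟩ : ∃ m, j = m + 1 := ⟨j - 1, by omega⟩
    exact (aux_shift (K := ModuleCat.of Λ (LinearMap.ker g)) (X := ModuleCat.of Λ (Fin r → Λ))
      T (LinearMap.ker g).subtype g (Submodule.injective_subtype _) hg hex hP m).2
      (h _ (by omega))

theorem aux_iso {Λ : Type u} [Ring Λ] {X M : ModuleCat.{u} Λ} (T : ModuleCat.{u} Λ)
    (e : X ≃ₗ[Λ] M) (i : ℕ) (h : Subsingleton (ExtGrp Λ i X T)) :
    Subsingleton (ExtGrp Λ i M T) := by
  have e' : (Opposite.op M) ≅ (Opposite.op X) := e.toModuleIso.op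
  have e2 := (((Ext ℤ (ModuleCat.{u} Λ) i).mapIso e').app T).toLinearEquiv
  exact e2.toEquiv.subsingleton

theorem aux_lower {Λ : Type u} [Ring Λ] (T : ModuleCat.{u} Λ) (n : ℕ) :
    ∀ M : ModuleCat.{u} Λ, ResolutionOfLength Λ (Perp Λ T) n M →
      ∀ j : ℕ, n < j → Subsingleton (ExtGrp Λ j M T) := by
  induction n with
  | zero =>
    rintro M ⟨X, hX, ⟨e⟩⟩ j hj
    exact aux_iso T e j (hX.2 j hj)
  | succ n ih =>
    rintro M ⟨X, hX, K, f, g, hf, hg, h, hK⟩ j hj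
    obtain ⟨m, rfl⟩ : ∃ m, j = m + 2 := ⟨j - 2, by omega⟩
    exact (aux_shift T f g hf hg h hX.2 m).1 (ih K hK (m + 1) (by omega))

theorem cotilting_id_eq_resdim_perp
    {R : Type u} [CommRing R] [IsArtinianRing R]
    {Λ : Type u} [Ring Λ] [Algebra R Λ] [Module.Finite R Λ]
    (T : ModuleCat.{u} Λ) (hT : IsCotilting Λ T) (d : ℕ)
    -- `T` has injective dimension `d` :
    (hidLE : ∀ (M : ModuleCat.{u} Λ) (j : ℕ), d < j → Subsingleton (ExtGrp Λ j M T))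
    (hidGE : 0 < d → ∃ M : ModuleCat.{u} Λ, ¬ Subsingleton (ExtGrp Λ d M T)) :
    (∀ M : ModuleCat.{u} Λ, Module.Finite Λ M → ResdimLE Λ (Perp Λ T) d M) ∧
    (∃ M : ModuleCat.{u} Λ, Module.Finite Λ M ∧ ResdimLE Λ (Perp Λ T) d M ∧
      ∀ k : ℕ, ResdimLE Λ (Perp Λ T) k M → d ≤ k) := by
  have : IsNoetherianRing Λ := by
    have : IsNoetherian R Λ := inferInstance
    exact isNoetherian_of_tower R this
  have hup : ∀ M : ModuleCat.{u} Λ, Module.Finite Λ M → ResdimLE Λ (Perp Λ T) d M :=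
    fun M hM => ⟨d, le_rfl, aux_upper T d M hM (hidLE M)⟩
  refine ⟨hup, ?_⟩
  rcases Nat.eq_zero_or_pos d with rfl | hd
  · exact ⟨T, hT.1, hup T hT.1, fun k _ => Nat.zero_le k⟩
  · obtain ⟨n, rfl⟩ : ∃ n, d = n + 1 := ⟨d - 1, by omega⟩
    obtain ⟨M', hM'⟩ := hidGE hd
    have : ∃ M : ModuleCat.{u} Λ, Module.Finite Λ M ∧ ¬ Subsingleton (ExtGrp Λ (n + 1) M T) := by
      by_contra hcon
      push Not at hcon
      exact hM' ((aux_bridge Λ n M' T).2 (aux_baer n T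
        (fun M hM => (aux_bridge Λ n M T).1 (hcon M hM)) M'))
    obtain ⟨M, hM, hne⟩ := this
    refine ⟨M, hM, hup M hM, ?_⟩
    rintro k ⟨m, hmk, hres⟩
    by_contra hlt
    exact hne (aux_lower T m M hres (n + 1) (by omega))
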